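/- Let the outcome take K ≥ 2 values: Y(0), Y(1) : Ω → 𝒴 = {y₁, …, y_K} and Y := Y(D). Fix x ∈ 𝒳 with P(X = x) > 0 and suppose: (Randomization) under P(·|S = e, X = x), D is independent of the pair (Y(0), Y(1)); (Positivity) P(S = e, X = x, D = d, Y = y_j) > 0 and P(S = o, X = x, Y = y_j) > 0 for all d ∈ {0, 1} and j ∈ {1, …, K}; (Stability) R is conditionally independent of S given (X, D, Y); (No direct effect) R is conditionally independent of D given (X, Y). Under P_x := P(·|X = x) define the treatment weights π_d := E_{P_x}[1{D = d, S = e} | σ(R)] / P(D = d, S = e | X = x) and the outcome weights γ_j := E_{P_x}[1{Y = y_j, S = o} | σ(R)] / P(Y = y_j, S = o | X = x). Then for each d ∈ {0, 1}, P_x-almost surely, π_d = Σ_{j=1}^{K} γ_j · P(Y(d) = y_j | S = e, X = x). -/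

import Mathlib

open MeasureTheory ProbabilityTheory

noncomputable section

/-- Sample indicator values: experimental (`e`) or observational (`o`). -/
inductive Sample : Type
  | e
  | o
deriving DecidableEq

instance : MeasurableSpace Sample := ⊤

/-- Real-valued indicator of a boolean (`{0,1}`-valued variable). -/
def b2r (b : Bool) : ℝ := if b then 1 else 0

/-- `CondIndepOf P R V W` : the conditional law of `R` given `V = v, W = w` agrees with
the conditional law of `R` given `V = v`, for all values with positive probability;
this is the notion of "R is conditionally independent of W given V" for variables with
countable ranges. -/
def CondIndepOf {Ω 𝓡 V W : Type*} [MeasurableSpace Ω] [MeasurableSpace 𝓡]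
    (P : Measure Ω) (R : Ω → 𝓡) (Vf : Ω → V) (Wf : Ω → W) : Prop :=
  ∀ v w, 0 < P {ω | Vf ω = v ∧ Wf ω = w} →
    (P[|{ω | Vf ω = v ∧ Wf ω = w}]).map R = (P[|{ω | Vf ω = v}]).map R

/-- A finite-valued measurable map partitions any measurable set into its fibres. -/
theorem measureReal_eq_sum_inter_fiber {Ω ι : Type*} [MeasurableSpace Ω] [Fintype ι]
    [MeasurableSpace ι] [MeasurableSingletonClass ι] (μ : Measure Ω) [IsFiniteMeasure μ]
    {f : Ω → ι} (hf : Measurable f) (T : Set Ω) :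
    μ.real T = ∑ i, μ.real (T ∩ f ⁻¹' {i}) := by
  have h := sum_measureReal_preimage_singleton (μ := μ.restrict T) (f := f) Finset.univ
    (fun i _ => hf (measurableSet_singleton i))
  simp only [Finset.coe_univ, Set.preimage_univ, measureReal_restrict_apply MeasurableSet.univ,
    Set.univ_inter] at h
  rw [← h]
  refine Finset.sum_congr rfl fun i _ => ?_
  rw [measureReal_restrict_apply (hf (measurableSet_singleton i)), Set.inter_comm]

/-- `μ[|s] t * μ s = μ (s ∩ t)` in real-valued form. -/
theorem cond_real_mul {Ω : Type*} [MeasurableSpace Ω] (μ : Measure Ω) [IsFiniteMeasure μ]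
    {s : Set Ω} (hs : MeasurableSet s) (t : Set Ω) :
    (μ[|s]).real t * μ.real s = μ.real (s ∩ t) := by
  simp only [measureReal_def, ← ENNReal.toReal_mul, cond_mul_eq_inter hs]

/-- Conditional independence as a product formula, valid also on null cells. -/
theorem CondIndepOf.measureReal_inter {Ω 𝓡 V W : Type*} [MeasurableSpace Ω] [MeasurableSpace 𝓡]
    {P : Measure Ω} [IsFiniteMeasure P] {R : Ω → 𝓡} {Vf : Ω → V} {Wf : Ω → W}
    (h : CondIndepOf P R Vf Wf) (hR : Measurable R) {v : V} {w : W}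
    (hE : MeasurableSet {ω | Vf ω = v ∧ Wf ω = w}) {B : Set 𝓡} (hB : MeasurableSet B) :
    P.real ({ω | Vf ω = v ∧ Wf ω = w} ∩ R ⁻¹' B) =
      (P[|{ω | Vf ω = v}]).real (R ⁻¹' B) * P.real {ω | Vf ω = v ∧ Wf ω = w} := by
  rcases eq_or_ne (P {ω | Vf ω = v ∧ Wf ω = w}) 0 with h0 | h0
  · have h1 := measure_mono_null (Set.inter_subset_left (t := R ⁻¹' B)) h0
    simp [measureReal_def, h0, h1]
  · have h1 := congrArg (fun m => m.real B) (h v w (pos_iff_ne_zero.2 h0))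
    simp only [map_measureReal_apply hR hB] at h1
    rw [← h1, cond_real_mul P hE]

/-- Integrable functions with equal integrals over all `m`-measurable sets have equal conditional
expectations. -/
theorem condExp_ae_eq_of_forall_setIntegral_eq {Ω : Type*} {m m0 : MeasurableSpace Ω}
    {μ : Measure Ω} [IsFiniteMeasure μ] (hm : m ≤ m0) {f g : Ω → ℝ} (hf : Integrable f μ)
    (hg : Integrable g μ)
    (h : ∀ s, MeasurableSet[m] s → ∫ ω in s, f ω ∂μ = ∫ ω in s, g ω ∂μ) :
    μ[f|m] =ᵐ[μ] μ[g|m] := by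
  refine ae_eq_condExp_of_forall_setIntegral_eq hm hg
    (fun s _ _ => integrable_condExp.integrableOn) (fun s hs _ => ?_)
    stronglyMeasurable_condExp.aestronglyMeasurable
  rw [setIntegral_condExp hm hf hs, h s hs]

/-- **Lemma (Bayes' rule for discrete outcomes).** The treatment weights equal the
outcome-weighted mixture: `π_d = Σ_j γ_j · P(Y(d) = y_j | S = e, X = x)` `P_x`-a.s. -/
theorem statement11
    {Ω 𝓡 𝓧 : Type*} [MeasurableSpace Ω] [MeasurableSpace 𝓡] [StandardBorelSpace 𝓡]
    [MeasurableSpace 𝓧] [MeasurableSingletonClass 𝓧] [Countable 𝓧]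
    (P : Measure Ω) [IsProbabilityMeasure P]
    (n : ℕ) (hn : 1 ≤ n)   -- K = n + 1 ≥ 2
    (S : Ω → Sample) (D : Ω → Bool) (Y0 Y1 : Ω → Fin (n + 1)) (R : Ω → 𝓡) (X : Ω → 𝓧)
    (hS : Measurable S) (hD : Measurable D) (hY0 : Measurable Y0) (hY1 : Measurable Y1)
    (hR : Measurable R) (hX : Measurable X)
    (Y : Ω → Fin (n + 1)) (hYdef : ∀ ω, Y ω = if D ω then Y1 ω else Y0 ω)
    (x : 𝓧) (hx : 0 < P {ω | X ω = x})
    -- Randomization: D ⫫ (Y(0), Y(1)) under P(·|S = e, X = x)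
    (randomization :
      IndepFun D (fun ω => (Y0 ω, Y1 ω)) (P[|{ω | S ω = Sample.e ∧ X ω = x}]))
    -- Positivity
    (positivity_e : ∀ (d : Bool) (j : Fin (n + 1)),
      0 < P {ω | S ω = Sample.e ∧ X ω = x ∧ D ω = d ∧ Y ω = j})
    (positivity_o : ∀ j : Fin (n + 1),
      0 < P {ω | S ω = Sample.o ∧ X ω = x ∧ Y ω = j})
    -- Stability: R ⫫ S | (X, D, Y)
    (stability : CondIndepOf P R (fun ω => (X ω, D ω, Y ω)) S)
    -- No direct effect: R ⫫ D | (X, Y)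
    (noDirectEffect : CondIndepOf P R (fun ω => (X ω, Y ω)) D)
    (d : Bool)
    -- Treatment weights: π_d := E_{P_x}[1{D=d,S=e} | σ(R)] / P(D=d,S=e | X=x)
    (π : Ω → ℝ)
    (hπ : π = fun ω =>
      ((P[|{ω' | X ω' = x}])[(fun ω' =>
          if D ω' = d ∧ S ω' = Sample.e then (1 : ℝ) else 0) |
        MeasurableSpace.comap R inferInstance]) ω /
      ((P[|{ω' | X ω' = x}]) {ω' | D ω' = d ∧ S ω' = Sample.e}).toReal)
    -- Outcome weights: γ_j := E_{P_x}[1{Y=y_j,S=o} | σ(R)] / P(Y=y_j,S=o | X=x)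
    (γ : Fin (n + 1) → Ω → ℝ)
    (hγ : ∀ j, γ j = fun ω =>
      ((P[|{ω' | X ω' = x}])[(fun ω' =>
          if Y ω' = j ∧ S ω' = Sample.o then (1 : ℝ) else 0) |
        MeasurableSpace.comap R inferInstance]) ω /
      ((P[|{ω' | X ω' = x}]) {ω' | Y ω' = j ∧ S ω' = Sample.o}).toReal) :
    ∀ᵐ ω ∂(P[|{ω' | X ω' = x}]),
      π ω = ∑ j : Fin (n + 1), γ j ω *
        ((P[|{ω' | S ω' = Sample.e ∧ X ω' = x}])
          {ω' | (if d then Y1 ω' else Y0 ω') = j}).toReal := by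
  have hY : Measurable Y := by
    rw [funext hYdef]
    exact Measurable.ite (hD (measurableSet_singleton true)) hY1 hY0
  have hmX : MeasurableSet {ω | X ω = x} := hX (measurableSet_singleton x)
  have hmS : ∀ s, MeasurableSet {ω | S ω = s} := fun s =>
    hS (t := {s}) MeasurableSpace.measurableSet_top
  have hmD : ∀ d, MeasurableSet {ω | D ω = d} := fun d => hD (measurableSet_singleton d)
  have hmY : ∀ j, MeasurableSet {ω | Y ω = j} := fun j => hY (measurableSet_singleton j)
  set μ := P[|{ω | X ω = x}]
  have : IsProbabilityMeasure μ := cond_isProbabilityMeasure hx.ne'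
  have hPX : 0 < P.real {ω | X ω = x} := ENNReal.toReal_pos hx.ne' (measure_ne_top _ _)
  have hmul : ∀ T, μ.real T * P.real {ω | X ω = x} = P.real ({ω | X ω = x} ∩ T) :=
    cond_real_mul P hmX
  have hμpos : ∀ T, 0 < P ({ω | X ω = x} ∩ T) → 0 < μ.real T := fun T hT =>
    pos_of_mul_pos_left (b := P.real {ω | X ω = x})
      (by rw [hmul]; exact ENNReal.toReal_pos hT.ne' (measure_ne_top _ _)) hPX.le
  let κ : Fin (n + 1) → Set 𝓡 → ℝ := fun j B =>
    (P[|{ω | (X ω, Y ω) = (x, j)}]).real (R ⁻¹' B)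
  -- the law of `R` on each cell is the same for all samples and treatments
  have cell : ∀ s d' j B, MeasurableSet B →
      μ.real ({ω | S ω = s ∧ D ω = d' ∧ Y ω = j} ∩ R ⁻¹' B) =
        κ j B * μ.real {ω | S ω = s ∧ D ω = d' ∧ Y ω = j} := by
    intro s d' j B hB
    have e1 : {ω | (X ω, D ω, Y ω) = (x, d', j) ∧ S ω = s} =
        {ω | X ω = x} ∩ {ω | S ω = s ∧ D ω = d' ∧ Y ω = j} := by
      ext ω; simp only [Prod.mk.injEq, Set.mem_ofPred_eq, Set.mem_inter_iff]; tauto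
    have e2 : {ω | (X ω, Y ω) = (x, j) ∧ D ω = d'} = {ω | (X ω, D ω, Y ω) = (x, d', j)} := by
      ext ω; simp only [Prod.mk.injEq, Set.mem_ofPred_eq]; tauto
    have hpos : 0 < P {ω | (X ω, Y ω) = (x, j) ∧ D ω = d'} := by
      refine (positivity_e d' j).trans_le (measure_mono fun ω => ?_)
      simp only [Prod.mk.injEq, Set.mem_ofPred_eq]; tauto
    have h1 := stability.measureReal_inter hR (v := (x, d', j)) (w := s)
      (e1 ▸ hmX.inter ((hmS s).inter ((hmD d').inter (hmY j)))) hB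
    have h2 := congrArg (fun m => m.real B) (noDirectEffect (x, j) d' hpos)
    simp only [map_measureReal_apply hR hB, e2] at h2
    rw [h2, e1, Set.inter_assoc, ← hmul, ← hmul, ← mul_assoc] at h1
    exact mul_right_cancel₀ hPX.ne' h1
  -- the experimental outcome probabilities, by randomization
  set q : Fin (n + 1) → ℝ := fun j => ((P[|{ω' | S ω' = Sample.e ∧ X ω' = x}])
          {ω' | (if d then Y1 ω' else Y0 ω') = j}).toReal
  have hqmul : ∀ j, q j * μ.real {ω | D ω = d ∧ S ω = Sample.e} =
      μ.real {ω | S ω = Sample.e ∧ D ω = d ∧ Y ω = j} := by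
    intro j
    have hmE : MeasurableSet {ω | S ω = Sample.e ∧ X ω = x} := (hmS _).inter hmX
    have h1 := randomization.measure_inter_preimage_eq_mul {d}
      {p | (if d then p.2 else p.1) = j} (measurableSet_singleton d) (Set.toFinite _).measurableSet
    have h2 := congrArg ENNReal.toReal h1
    rw [ENNReal.toReal_mul] at h2
    simp only [← measureReal_def] at h2
    have h3 := congrArg (· * P.real {ω | S ω = Sample.e ∧ X ω = x}) h2
    simp only [mul_right_comm, cond_real_mul P hmE] at h3
    have e1 : {ω | S ω = Sample.e ∧ X ω = x} ∩
        (D ⁻¹' {d} ∩ (fun ω => (Y0 ω, Y1 ω)) ⁻¹' {p | (if d then p.2 else p.1) = j}) =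
        {ω | X ω = x} ∩ {ω | S ω = Sample.e ∧ D ω = d ∧ Y ω = j} := by
      ext ω
      simp only [Set.mem_inter_iff, Set.mem_preimage, Set.mem_singleton_iff, Set.mem_ofPred_eq,
        hYdef]
      constructor
      · exact fun ⟨⟨hs, hx'⟩, hd, hy⟩ => ⟨hx', hs, hd, by rwa [hd]⟩
      · exact fun ⟨hx', hs, hd, hy⟩ => ⟨⟨hs, hx'⟩, hd, by rwa [hd] at hy⟩
    have e2 : {ω | S ω = Sample.e ∧ X ω = x} ∩ D ⁻¹' {d} =
        {ω | X ω = x} ∩ {ω | D ω = d ∧ S ω = Sample.e} := by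
      ext ω
      simp only [Set.mem_inter_iff, Set.mem_preimage, Set.mem_singleton_iff, Set.mem_ofPred_eq]
      tauto
    rw [e1, e2, ← hmul, ← hmul] at h3
    refine mul_right_cancel₀ hPX.ne' (Eq.trans ?_ h3.symm)
    change (P[|{ω' | S ω' = Sample.e ∧ X ω' = x}]).real _ * _ * _ = _
    rw [mul_assoc, mul_comm]
    rfl
  have hpd : 0 < μ.real {ω | D ω = d ∧ S ω = Sample.e} := by
    refine hμpos _ ((positivity_e d 0).trans_le (measure_mono fun ω => ?_))
    simp only [Set.mem_inter_iff, Set.mem_ofPred_eq]; tauto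
  have hpj : ∀ j, 0 < μ.real {ω | Y ω = j ∧ S ω = Sample.o} := by
    intro j
    refine hμpos _ ((positivity_o j).trans_le (measure_mono fun ω => ?_))
    simp only [Set.mem_inter_iff, Set.mem_ofPred_eq]; tauto
  have treat : ∀ B, MeasurableSet B → μ.real ({ω | D ω = d ∧ S ω = Sample.e} ∩ R ⁻¹' B) =
      (∑ j, q j * κ j B) * μ.real {ω | D ω = d ∧ S ω = Sample.e} := by
    intro B hB
    rw [measureReal_eq_sum_inter_fiber μ hY, Finset.sum_mul]
    refine Finset.sum_congr rfl fun j _ => ?_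
    rw [mul_right_comm, hqmul, mul_comm, ← cell _ _ _ _ hB]
    congr 1; ext ω
    simp only [Set.mem_inter_iff, Set.mem_preimage, Set.mem_singleton_iff, Set.mem_ofPred_eq]
    tauto
  have outc : ∀ j B, MeasurableSet B → μ.real ({ω | Y ω = j ∧ S ω = Sample.o} ∩ R ⁻¹' B) =
      κ j B * μ.real {ω | Y ω = j ∧ S ω = Sample.o} := by
    intro j B hB
    rw [measureReal_eq_sum_inter_fiber μ hD,
      measureReal_eq_sum_inter_fiber μ hD {ω | Y ω = j ∧ S ω = Sample.o}, Finset.mul_sum]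
    refine Finset.sum_congr rfl fun d' _ => ?_
    have e : {ω | Y ω = j ∧ S ω = Sample.o} ∩ D ⁻¹' {d'} =
        {ω | S ω = Sample.o ∧ D ω = d' ∧ Y ω = j} := by
      ext ω
      simp only [Set.mem_inter_iff, Set.mem_preimage, Set.mem_singleton_iff, Set.mem_ofPred_eq]
      tauto
    rw [Set.inter_right_comm, e, cell _ _ _ _ hB]
  have hm : MeasurableSpace.comap R inferInstance ≤ (inferInstance : MeasurableSpace Ω) :=
    hR.comap_le
  have hmT : MeasurableSet {ω | D ω = d ∧ S ω = Sample.e} := (hmD d).inter (hmS _)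
  have hmO : ∀ j, MeasurableSet {ω | Y ω = j ∧ S ω = Sample.o} := fun j => (hmY j).inter (hmS _)
  set f : Ω → ℝ := fun ω => if D ω = d ∧ S ω = Sample.e then (1 : ℝ) else 0
  set g : Fin (n + 1) → Ω → ℝ := fun j ω => if Y ω = j ∧ S ω = Sample.o then (1 : ℝ) else 0
  have hf1 : f = {ω | D ω = d ∧ S ω = Sample.e}.indicator 1 := by
    ext ω; simp [f, Set.indicator_apply]
  have hg1 : ∀ j, g j = {ω | Y ω = j ∧ S ω = Sample.o}.indicator 1 := by
    intro j; ext ω; simp [g, Set.indicator_apply]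
  have hfi : Integrable f μ := hf1 ▸ (integrable_const (1 : ℝ)).indicator hmT
  have hgi : ∀ j, Integrable (g j) μ := fun j =>
    hg1 j ▸ (integrable_const (1 : ℝ)).indicator (hmO j)
  let pd := μ.real {ω | D ω = d ∧ S ω = Sample.e}
  let c : Fin (n + 1) → ℝ := fun j => pd * q j / μ.real {ω | Y ω = j ∧ S ω = Sample.o}
  have hcgi : ∀ j ∈ Finset.univ, Integrable (c j • g j) μ := fun j _ => (hgi j).smul _
  have hset : ∀ s, MeasurableSet[MeasurableSpace.comap R inferInstance] s →
      ∫ ω in s, f ω ∂μ = ∫ ω in s, (∑ j, c j • g j) ω ∂μ := by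
    rintro _ ⟨B, hB, rfl⟩
    simp only [Finset.sum_apply, Pi.smul_apply, smul_eq_mul]
    rw [integral_finsetSum _ fun j _ => ((hgi j).const_mul _).integrableOn]
    simp only [integral_const_mul, hf1, hg1]
    rw [integral_indicator_one hmT, measureReal_restrict_apply hmT, treat B hB, Finset.sum_mul]
    refine Finset.sum_congr rfl fun j _ => ?_
    rw [integral_indicator_one (hmO j), measureReal_restrict_apply (hmO j), outc j B hB]
    have := (hpj j).ne'
    simp only [c, pd]
    field_simp
  have hsum : ∀ᵐ ω ∂μ, ∀ j, (μ[c j • g j|MeasurableSpace.comap R inferInstance]) ω =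
      c j * (μ[g j|MeasurableSpace.comap R inferInstance]) ω :=
    ae_all_iff.2 fun j => condExp_smul (c j) (g j) _
  filter_upwards [condExp_ae_eq_of_forall_setIntegral_eq hm hfi
      (integrable_finsetSum' _ hcgi) hset,
    condExp_finsetSum hcgi (MeasurableSpace.comap R inferInstance), hsum] with ω h1 h2 h3
  rw [hπ]
  simp only [hγ, ← measureReal_def]
  rw [h1, h2, Finset.sum_apply, Finset.sum_div]
  refine Finset.sum_congr rfl fun j _ => ?_
  rw [h3]
  have := (hpj j).ne'
  simp only [c, pd]
  field_simp
  exact mul_comm _ _
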